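/- arXiv:math/0405572 — 5 statements merged into one kernel-verified Lean document; each statement's English description precedes it below -/
import Mathlib

section
/- Let ρ be a density matrix on ℂ^d, let ρ̇ be a Hermitian d×d complex matrix, and let λ be a Hermitian d×d matrix satisfying ρ̇ = (1/2)(λρ + ρλ). Let (m x)_{x∈X} be a POVM with finite outcome set X on ℂ^d, and for each x set p(x) = trace(ρ · m x) and ṗ(x) = trace(ρ̇ · m x) (both are real numbers). Then the Fisher information of the measurement is bounded by the quantum Fisher information: ∑_{x : p(x) ≠ 0} ṗ(x)² / p(x) ≤ trace(ρ · λ²). -/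
open Matrix BigOperators
open scoped ComplexOrder

lemma bc_trace_mul_nonneg {d : ℕ} (A B : Matrix (Fin d) (Fin d) ℂ)
    (hA : A.PosSemidef) (hB : B.PosSemidef) : 0 ≤ ((A * B).trace).re := by
  open scoped MatrixOrder in
  obtain ⟨C, rfl⟩ := CStarAlgebra.nonneg_iff_eq_star_mul_self.mp hA.nonneg
  have h := (hB.mul_mul_conjTranspose_same C).trace_nonneg
  have e : (star C * C * B).trace = (C * B * Cᴴ).trace := by
    rw [Matrix.mul_assoc, Matrix.trace_mul_comm, star_eq_conjTranspose]
  rw [e]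
  exact (Complex.le_def.mp h).1

/-- Braunstein–Caves quantum information inequality (finite-outcome form):
the Fisher information of any POVM is bounded by the quantum Fisher information. -/
theorem braunstein_caves_information_bound
    {d : ℕ} {X : Type*} [Fintype X]
    (ρ ρdot lam : Matrix (Fin d) (Fin d) ℂ)
    (hρ : ρ.PosSemidef) (hρtr : ρ.trace = 1)
    (hρdot : ρdot.IsHermitian) (hlam : lam.IsHermitian)
    (hscore : ρdot = (1 / 2 : ℂ) • (lam * ρ + ρ * lam))
    (m : X → Matrix (Fin d) (Fin d) ℂ)
    (hm : ∀ x, (m x).PosSemidef) (hmsum : ∑ x, m x = 1)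
    (p pdot : X → ℝ)
    (hp : ∀ x, p x = ((ρ * m x).trace).re)
    (hpdot : ∀ x, pdot x = ((ρdot * m x).trace).re) :
    ∑ x ∈ Finset.univ.filter (fun x => p x ≠ 0), (pdot x) ^ 2 / p x
      ≤ ((ρ * lam ^ 2).trace).re := by
  have key : ∀ x (t : ℝ),
      0 ≤ ((ρ * (lam * m x * lam)).trace).re - 2 * t * pdot x + t ^ 2 * p x := by
    intro x t
    have hH : (lam - (t : ℂ) • (1 : Matrix (Fin d) (Fin d) ℂ))ᴴ
        = lam - (t : ℂ) • (1 : Matrix (Fin d) (Fin d) ℂ) := by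
      simp [conjTranspose_sub, conjTranspose_smul, hlam.eq]
    have h1 := (hm x).mul_mul_conjTranspose_same
      (lam - (t : ℂ) • (1 : Matrix (Fin d) (Fin d) ℂ))
    rw [hH] at h1
    have h2 := bc_trace_mul_nonneg _ _ hρ h1
    have e : (ρ * ((lam - (t : ℂ) • (1 : Matrix (Fin d) (Fin d) ℂ)) * m x *
        (lam - (t : ℂ) • (1 : Matrix (Fin d) (Fin d) ℂ)))).trace
        = (ρ * (lam * m x * lam)).trace - ((2 * t : ℝ) : ℂ) * (ρdot * m x).trace
          + ((t ^ 2 : ℝ) : ℂ) * (ρ * m x).trace := by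
      have c : (ρ * (m x * lam)).trace = (lam * (ρ * m x)).trace := by
        rw [← Matrix.mul_assoc, Matrix.trace_mul_comm]
      rw [hscore]
      simp only [sub_mul, mul_sub, add_mul, smul_mul_assoc, mul_smul_comm, one_mul, mul_one,
        trace_sub, trace_add, trace_smul, smul_eq_mul, Matrix.mul_assoc, c]
      push_cast
      ring
    rw [e, Complex.add_re, Complex.sub_re, Complex.re_ofReal_mul, Complex.re_ofReal_mul,
      ← hp, ← hpdot] at h2
    exact h2
  have hsum : ((ρ * lam ^ 2).trace).re = ∑ x, ((ρ * (lam * m x * lam)).trace).re := by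
    rw [← Complex.re_sum, ← trace_sum, ← Finset.mul_sum, ← Finset.sum_mul, ← Finset.mul_sum,
      hmsum, mul_one, pow_two]
  rw [hsum]
  calc _ ≤ ∑ x ∈ Finset.univ.filter (fun x => p x ≠ 0), ((ρ * (lam * m x * lam)).trace).re := by
        refine Finset.sum_le_sum fun x hx => ?_
        have hx0 : p x ≠ 0 := (Finset.mem_filter.mp hx).2
        have h := key x (pdot x / p x)
        have e : 2 * (pdot x / p x) * pdot x = 2 * (pdot x ^ 2 / p x) := by ring
        have e2 : (pdot x / p x) ^ 2 * p x = pdot x ^ 2 / p x := by field_simp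
        rw [e, e2] at h
        linarith
    _ ≤ _ := by
        refine Finset.sum_le_sum_of_subset_of_nonneg (Finset.filter_subset _ _) fun x _ _ => ?_
        simpa using key x 0
end

section
/- Let ρ be a density matrix on ℂ^d and let ρ̇ and λ be Hermitian d×d matrices with ρ̇ = (1/2)(λρ + ρλ). Suppose λ has spectral decomposition λ = ∑_{x∈X} v(x) Π x, where X is finite, v : X → ℝ, and (Π x)_{x∈X} are Hermitian idempotent matrices with Π x · Π y = 0 for x ≠ y and ∑_{x∈X} Π x = 1. Then for every x, trace(ρ̇ · Π x) = v(x) · trace(ρ · Π x), and consequently the Fisher information of the simple measurement (Π x) attains the quantum Fisher information: ∑_{x : trace(ρ·Π x) ≠ 0} trace(ρ̇ · Π x)² / trace(ρ · Π x) = trace(ρ · λ²). -/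
open Matrix BigOperators
open scoped ComplexOrder

/-- Measuring the quantum score observable attains the quantum information bound:
if λ = ∑ v(x) P x is the spectral decomposition of the quantum score, then
trace(ρ̇ P x) = v(x) trace(ρ P x) for all x, and the Fisher information of the
simple measurement (P x) equals the quantum Fisher information trace(ρ λ²). -/
theorem score_measurement_attains_bound
    {d : ℕ} {X : Type*} [Fintype X]
    (ρ ρdot lam : Matrix (Fin d) (Fin d) ℂ)
    (hρ : ρ.PosSemidef) (hρtr : ρ.trace = 1)
    (hρdot : ρdot.IsHermitian) (hlam : lam.IsHermitian)
    (hscore : ρdot = (1 / 2 : ℂ) • (lam * ρ + ρ * lam))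
    (v : X → ℝ) (P : X → Matrix (Fin d) (Fin d) ℂ)
    (hherm : ∀ x, (P x).IsHermitian) (hidem : ∀ x, P x * P x = P x)
    (horth : ∀ x y, x ≠ y → P x * P y = 0) (hsum : ∑ x, P x = 1)
    (hspec : lam = ∑ x, (v x : ℂ) • P x) :
    (∀ x, (ρdot * P x).trace = (v x : ℂ) * (ρ * P x).trace) ∧
    ∑ x ∈ Finset.univ.filter (fun x => ((ρ * P x).trace).re ≠ 0),
        (((ρdot * P x).trace).re) ^ 2 / ((ρ * P x).trace).re
      = ((ρ * lam ^ 2).trace).re := by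
  classical
  have hL : ∀ x, lam * P x = (v x : ℂ) • P x := by
    intro x
    rw [hspec, Finset.sum_mul, Finset.sum_eq_single x]
    · rw [smul_mul_assoc, hidem]
    · intro y _ hy
      rw [smul_mul_assoc, horth y x hy, smul_zero]
    · intro h
      exact absurd (Finset.mem_univ x) h
  have hR : ∀ x, P x * lam = (v x : ℂ) • P x := by
    intro x
    rw [hspec, Finset.mul_sum, Finset.sum_eq_single x]
    · rw [mul_smul_comm, hidem]
    · intro y _ hy
      rw [mul_smul_comm, horth x y (Ne.symm hy), smul_zero]
    · intro h
      exact absurd (Finset.mem_univ x) h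
  have h1 : ∀ x, (ρdot * P x).trace = (v x : ℂ) * (ρ * P x).trace := by
    intro x
    have ha : (lam * ρ * P x).trace = (v x : ℂ) * (ρ * P x).trace := by
      rw [Matrix.mul_assoc, Matrix.trace_mul_comm, Matrix.mul_assoc, hR, mul_smul_comm,
        Matrix.trace_smul, smul_eq_mul]
    have hb : (ρ * lam * P x).trace = (v x : ℂ) * (ρ * P x).trace := by
      rw [Matrix.mul_assoc, hL, mul_smul_comm, Matrix.trace_smul, smul_eq_mul]
    rw [hscore, smul_mul_assoc, Matrix.add_mul, Matrix.trace_smul, Matrix.trace_add, ha, hb,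
      smul_eq_mul]
    ring
  refine ⟨h1, ?_⟩
  have h2 : lam ^ 2 = ∑ x, ((v x ^ 2 : ℝ) : ℂ) • P x := by
    calc lam ^ 2 = lam * ∑ x, (v x : ℂ) • P x := by rw [← hspec, sq]
      _ = _ := by
        rw [Finset.mul_sum]
        refine Finset.sum_congr rfl fun x _ => ?_
        rw [mul_smul_comm, hL, smul_smul]
        push_cast
        rw [sq]
  have h3 : ((ρ * lam ^ 2).trace).re = ∑ x, v x ^ 2 * ((ρ * P x).trace).re := by
    rw [h2, Finset.mul_sum, Matrix.trace_sum, Complex.re_sum]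
    refine Finset.sum_congr rfl fun x _ => ?_
    rw [mul_smul_comm, Matrix.trace_smul, smul_eq_mul, Complex.re_ofReal_mul]
  rw [h3, Finset.sum_filter]
  refine Finset.sum_congr rfl fun x _ => ?_
  rw [h1, Complex.re_ofReal_mul]
  by_cases h : ((ρ * P x).trace).re = 0
  · simp [h]
  · rw [if_pos h]
    field_simp
end

section
/- Let ρ be a density matrix on ℂ^d and σ a density matrix on ℂ^{d'}; let ρ̇, σ̇ be Hermitian matrices with trace(ρ̇) = 0 and trace(σ̇) = 0, and let λ, μ be Hermitian matrices with ρ̇ = (1/2)(λρ + ρλ) and σ̇ = (1/2)(μσ + σμ). Let ⊗ denote the Kronecker product and let Λ = λ ⊗ 1_{d'} + 1_d ⊗ μ. Then Λ is Hermitian, Λ is a quantum score for the product state: ρ̇ ⊗ σ + ρ ⊗ σ̇ = (1/2)(Λ(ρ⊗σ) + (ρ⊗σ)Λ), and the quantum Fisher information is additive: trace((ρ⊗σ) · Λ²) = trace(ρ · λ²) + trace(σ · μ²). -/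
open Matrix
open scoped ComplexOrder Kronecker

/-- Additivity of the quantum Fisher information under tensor (Kronecker) products:
Λ = λ ⊗ 1 + 1 ⊗ μ is a quantum score for the product state, and
trace((ρ⊗σ)Λ²) = trace(ρλ²) + trace(σμ²). -/
theorem quantum_information_additive
    {d d' : ℕ}
    (ρ ρdot lam : Matrix (Fin d) (Fin d) ℂ)
    (σ σdot mu : Matrix (Fin d') (Fin d') ℂ)
    (hρ : ρ.PosSemidef) (hρtr : ρ.trace = 1)
    (hσ : σ.PosSemidef) (hσtr : σ.trace = 1)
    (hρdot : ρdot.IsHermitian) (hρdottr : ρdot.trace = 0)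
    (hσdot : σdot.IsHermitian) (hσdottr : σdot.trace = 0)
    (hlam : lam.IsHermitian) (hmu : mu.IsHermitian)
    (hscoreρ : ρdot = (1 / 2 : ℂ) • (lam * ρ + ρ * lam))
    (hscoreσ : σdot = (1 / 2 : ℂ) • (mu * σ + σ * mu))
    (Λ : Matrix (Fin d × Fin d') (Fin d × Fin d') ℂ)
    (hΛ : Λ = lam ⊗ₖ (1 : Matrix (Fin d') (Fin d') ℂ)
            + (1 : Matrix (Fin d) (Fin d) ℂ) ⊗ₖ mu) :
    Λ.IsHermitian ∧
    ρdot ⊗ₖ σ + ρ ⊗ₖ σdot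
      = (1 / 2 : ℂ) • (Λ * (ρ ⊗ₖ σ) + (ρ ⊗ₖ σ) * Λ) ∧
    ((ρ ⊗ₖ σ) * Λ ^ 2).trace = (ρ * lam ^ 2).trace + (σ * mu ^ 2).trace := by
  have h1 : (ρ * lam).trace = 0 := by
    have h := hρdottr
    rw [hscoreρ, trace_smul, trace_add, trace_mul_comm lam ρ, smul_eq_mul] at h
    linear_combination h
  subst hΛ
  refine ⟨?_, ?_, ?_⟩
  · unfold Matrix.IsHermitian
    rw [conjTranspose_add, conjTranspose_kronecker, conjTranspose_kronecker, hlam.eq, hmu.eq,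
      conjTranspose_one, conjTranspose_one]
  · rw [hscoreρ, hscoreσ]
    simp only [add_mul, mul_add, ← mul_kronecker_mul, one_mul, mul_one, smul_kronecker,
      kronecker_smul, add_kronecker, kronecker_add, smul_add]
    abel
  · simp only [pow_two, add_mul, mul_add, ← mul_kronecker_mul, one_mul, mul_one, trace_add,
      trace_kronecker, hρtr, hσtr, h1, zero_mul, add_zero, zero_add]
end

section
/- Let X be a finite set and let f be a map from the set of density matrices on ℂ^d to probability distributions on X (i.e. f(ρ) : X → ℝ with f(ρ)(x) ≥ 0 for all x and ∑_{x∈X} f(ρ)(x) = 1). Suppose f is affine: for all density matrices ρ, σ and all t ∈ [0,1], f(tρ + (1−t)σ) = t·f(ρ) + (1−t)·f(σ) (pointwise in x). Then there exists a POVM (M x)_{x∈X} on ℂ^d such that f(ρ)(x) = trace(ρ · M x) for every density matrix ρ and every x ∈ X. -/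
open Matrix BigOperators
open scoped ComplexOrder

/-- homogeneous extension of a function on states to the cone -/
noncomputable def coneExt {d : ℕ} (h : Matrix (Fin d) (Fin d) ℂ → ℝ)
    (A : Matrix (Fin d) (Fin d) ℂ) : ℝ :=
  A.trace.re * h (((A.trace.re⁻¹ : ℝ) : ℂ) • A)

theorem trace_eq_re {d : ℕ} {A : Matrix (Fin d) (Fin d) ℂ} (hA : A.PosSemidef) :
    A.trace = (A.trace.re : ℂ) ∧ 0 ≤ A.trace.re := by
  have := hA.trace_nonneg
  rw [Complex.le_def] at this
  refine ⟨Complex.ext rfl ?_, by simpa using this.1⟩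
  simpa using this.2.symm

theorem psd_smul {d : ℕ} {A : Matrix (Fin d) (Fin d) ℂ} (hA : A.PosSemidef) {c : ℝ} (hc : 0 ≤ c) :
    ((c : ℂ) • A).PosSemidef := hA.smul (by exact_mod_cast hc)

theorem norm_state {d : ℕ} {A : Matrix (Fin d) (Fin d) ℂ} (hA : A.PosSemidef)
    (h0 : A.trace.re ≠ 0) :
    (((A.trace.re⁻¹ : ℝ) : ℂ) • A).PosSemidef ∧ (((A.trace.re⁻¹ : ℝ) : ℂ) • A).trace = 1 := by
  obtain ⟨h1, h2⟩ := trace_eq_re hA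
  refine ⟨psd_smul hA (inv_nonneg.2 h2), ?_⟩
  rw [trace_smul, h1, smul_eq_mul, Complex.ofReal_re, ← Complex.ofReal_mul, inv_mul_cancel₀ h0]
  simp

theorem psd_zero {d : ℕ} {A : Matrix (Fin d) (Fin d) ℂ} (hA : A.PosSemidef)
    (h0 : A.trace.re = 0) : A = 0 := by
  rw [← hA.trace_eq_zero_iff, (trace_eq_re hA).1, h0]; simp

theorem coneExt_zero {d : ℕ} (h : Matrix (Fin d) (Fin d) ℂ → ℝ) : coneExt h 0 = 0 := by
  simp [coneExt]

theorem coneExt_nonneg {d : ℕ} {h : Matrix (Fin d) (Fin d) ℂ → ℝ}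
    (hn : ∀ ρ : Matrix (Fin d) (Fin d) ℂ, ρ.PosSemidef → ρ.trace = 1 → 0 ≤ h ρ)
    {A : Matrix (Fin d) (Fin d) ℂ} (hA : A.PosSemidef) : 0 ≤ coneExt h A := by
  by_cases h0 : A.trace.re = 0
  · simp [coneExt, h0]
  · exact mul_nonneg (trace_eq_re hA).2 (hn _ (norm_state hA h0).1 (norm_state hA h0).2)

theorem coneExt_smul {d : ℕ} (h : Matrix (Fin d) (Fin d) ℂ → ℝ)
    (A : Matrix (Fin d) (Fin d) ℂ) (c : ℝ) :
    coneExt h ((c : ℂ) • A) = c * coneExt h A := by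
  by_cases hc : c = 0
  · simp [hc, coneExt_zero]
  have e : ((c : ℂ) • A).trace.re = c * A.trace.re := by simp [trace_smul]
  have hc' : (c : ℂ) ≠ 0 := by exact_mod_cast hc
  unfold coneExt
  rw [e, smul_smul, mul_assoc]
  congr 4
  push_cast
  field_simp

/-- affine on states -/
def AffOn {d : ℕ} (h : Matrix (Fin d) (Fin d) ℂ → ℝ) : Prop :=
  ∀ ρ σ : Matrix (Fin d) (Fin d) ℂ, ρ.PosSemidef → ρ.trace = 1 →
      σ.PosSemidef → σ.trace = 1 → ∀ t : ℝ, 0 ≤ t → t ≤ 1 →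
      h ((t : ℂ) • ρ + ((1 - t : ℝ) : ℂ) • σ) = t * h ρ + (1 - t) * h σ

theorem coneExt_add {d : ℕ} {h : Matrix (Fin d) (Fin d) ℂ → ℝ} (ha : AffOn h)
    {A B : Matrix (Fin d) (Fin d) ℂ} (hA : A.PosSemidef) (hB : B.PosSemidef) :
    coneExt h (A + B) = coneExt h A + coneExt h B := by
  by_cases hA0 : A.trace.re = 0
  · rw [psd_zero hA hA0]; simp [coneExt_zero]
  by_cases hB0 : B.trace.re = 0
  · rw [psd_zero hB hB0]; simp [coneExt_zero]
  obtain ⟨a1, a2⟩ := norm_state hA hA0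
  obtain ⟨b1, b2⟩ := norm_state hB hB0
  have pa := lt_of_le_of_ne (trace_eq_re hA).2 (Ne.symm hA0)
  have pb := lt_of_le_of_ne (trace_eq_re hB).2 (Ne.symm hB0)
  have key := ha _ _ a1 a2 b1 b2 (A.trace.re / (A.trace.re + B.trace.re)) (by positivity)
    (by rw [div_le_one (by positivity)]; linarith)
  unfold coneExt
  have e : (A + B).trace.re = A.trace.re + B.trace.re := by simp [trace_add]
  rw [e]
  generalize A.trace.re = a at *
  generalize B.trace.re = b at *
  have hab : a + b ≠ 0 := by positivity
  have e1 : 1 - a / (a + b) = b / (a + b) := by field_simp; ring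
  rw [e1, smul_smul, smul_smul, ← Complex.ofReal_mul, ← Complex.ofReal_mul] at key
  have e2 : a / (a + b) * a⁻¹ = (a + b)⁻¹ := by field_simp
  have e3 : b / (a + b) * b⁻¹ = (a + b)⁻¹ := by field_simp
  rw [e2, e3, ← smul_add] at key
  rw [key]
  field_simp

noncomputable def hPart {d : ℕ} (A : Matrix (Fin d) (Fin d) ℂ) : Matrix (Fin d) (Fin d) ℂ :=
  ((2⁻¹ : ℝ) : ℂ) • (A + Aᴴ)

noncomputable def pPart {d : ℕ} (A : Matrix (Fin d) (Fin d) ℂ) : Matrix (Fin d) (Fin d) ℂ :=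
  ((4⁻¹ : ℝ) : ℂ) • ((1 + hPart A)ᴴ * (1 + hPart A))

noncomputable def nPart {d : ℕ} (A : Matrix (Fin d) (Fin d) ℂ) : Matrix (Fin d) (Fin d) ℂ :=
  ((4⁻¹ : ℝ) : ℂ) • ((1 - hPart A)ᴴ * (1 - hPart A))

theorem pPart_psd {d : ℕ} (A : Matrix (Fin d) (Fin d) ℂ) : (pPart A).PosSemidef :=
  psd_smul (posSemidef_conjTranspose_mul_self _) (by norm_num)

theorem nPart_psd {d : ℕ} (A : Matrix (Fin d) (Fin d) ℂ) : (nPart A).PosSemidef :=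
  psd_smul (posSemidef_conjTranspose_mul_self _) (by norm_num)

theorem hPart_herm {d : ℕ} (A : Matrix (Fin d) (Fin d) ℂ) : (hPart A)ᴴ = hPart A := by
  unfold hPart
  rw [conjTranspose_smul, conjTranspose_add, conjTranspose_conjTranspose, add_comm]
  simp

theorem p_sub_n {d : ℕ} (A : Matrix (Fin d) (Fin d) ℂ) : pPart A - nPart A = hPart A := by
  unfold pPart nPart
  rw [conjTranspose_add, conjTranspose_sub, hPart_herm, conjTranspose_one, ← smul_sub]
  have : (1 + hPart A) * (1 + hPart A) - (1 - hPart A) * (1 - hPart A) = (4 : ℂ) • hPart A := by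
    have h4 : (4 : ℂ) • hPart A = hPart A + hPart A + hPart A + hPart A := by module
    rw [h4]; noncomm_ring
  rw [this, smul_smul]
  simp

theorem hPart_of_herm {d : ℕ} {A : Matrix (Fin d) (Fin d) ℂ} (hA : Aᴴ = A) : hPart A = A := by
  unfold hPart
  rw [hA, ← two_smul ℂ, smul_smul]; simp

theorem hPart_add {d : ℕ} (A B : Matrix (Fin d) (Fin d) ℂ) :
    hPart (A + B) = hPart A + hPart B := by
  unfold hPart
  rw [conjTranspose_add]; module

theorem hPart_smul {d : ℕ} (c : ℝ) (A : Matrix (Fin d) (Fin d) ℂ) :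
    hPart ((c : ℂ) • A) = (c : ℂ) • hPart A := by
  unfold hPart
  rw [conjTranspose_smul]; simp; module

noncomputable def linExt {d : ℕ} (h : Matrix (Fin d) (Fin d) ℂ → ℝ)
    (A : Matrix (Fin d) (Fin d) ℂ) : ℝ := coneExt h (pPart A) - coneExt h (nPart A)

theorem linExt_eq {d : ℕ} {h : Matrix (Fin d) (Fin d) ℂ → ℝ} (ha : AffOn h)
    {A P Q : Matrix (Fin d) (Fin d) ℂ} (hP : P.PosSemidef) (hQ : Q.PosSemidef)
    (e : P - Q = hPart A) : linExt h A = coneExt h P - coneExt h Q := by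
  have e1 : pPart A + Q = P + nPart A := by
    rw [← p_sub_n, sub_eq_sub_iff_add_eq_add] at e
    exact e.symm
  have := congrArg (coneExt h) e1
  rw [coneExt_add ha (pPart_psd A) hQ, coneExt_add ha hP (nPart_psd A)] at this
  unfold linExt
  linarith

theorem linExt_psd {d : ℕ} {h : Matrix (Fin d) (Fin d) ℂ → ℝ} (ha : AffOn h)
    {A : Matrix (Fin d) (Fin d) ℂ} (hA : A.PosSemidef) : linExt h A = coneExt h A := by
  rw [linExt_eq ha hA PosSemidef.zero (by rw [hPart_of_herm hA.1, sub_zero]), coneExt_zero,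
    sub_zero]

theorem linExt_add {d : ℕ} {h : Matrix (Fin d) (Fin d) ℂ → ℝ} (ha : AffOn h)
    (A B : Matrix (Fin d) (Fin d) ℂ) : linExt h (A + B) = linExt h A + linExt h B := by
  rw [linExt_eq ha ((pPart_psd A).add (pPart_psd B)) ((nPart_psd A).add (nPart_psd B))
    (by rw [hPart_add, ← p_sub_n, ← p_sub_n]; abel),
    coneExt_add ha (pPart_psd A) (pPart_psd B), coneExt_add ha (nPart_psd A) (nPart_psd B)]
  unfold linExt; ring

theorem linExt_skew {d : ℕ} {h : Matrix (Fin d) (Fin d) ℂ → ℝ} (ha : AffOn h)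
    {A : Matrix (Fin d) (Fin d) ℂ} (hA : Aᴴ = -A) : linExt h A = 0 := by
  rw [linExt_eq ha (P := 0) (Q := 0) PosSemidef.zero PosSemidef.zero (by simp [hPart, hA]), sub_self]

theorem linExt_smul {d : ℕ} {h : Matrix (Fin d) (Fin d) ℂ → ℝ} (ha : AffOn h)
    (c : ℝ) (A : Matrix (Fin d) (Fin d) ℂ) : linExt h ((c : ℂ) • A) = c * linExt h A := by
  rcases le_total 0 c with hc | hc
  · rw [linExt_eq ha (psd_smul (pPart_psd A) hc) (psd_smul (nPart_psd A) hc)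
      (by rw [hPart_smul, ← smul_sub, p_sub_n]), coneExt_smul, coneExt_smul]
    unfold linExt; ring
  · have hc' : 0 ≤ -c := by linarith
    rw [linExt_eq ha (psd_smul (nPart_psd A) hc') (psd_smul (pPart_psd A) hc')
      (by rw [hPart_smul, ← p_sub_n]; push_cast; module), coneExt_smul, coneExt_smul]
    unfold linExt; ring

noncomputable def linMap {d : ℕ} {h : Matrix (Fin d) (Fin d) ℂ → ℝ} (ha : AffOn h) :
    Matrix (Fin d) (Fin d) ℂ →ₗ[ℝ] ℝ where
  toFun := linExt h
  map_add' := linExt_add ha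
  map_smul' c A := by
    have := linExt_smul ha c A
    rwa [Complex.coe_smul] at this

/-- the representing matrix -/
noncomputable def repM {d : ℕ} (h : Matrix (Fin d) (Fin d) ℂ → ℝ) : Matrix (Fin d) (Fin d) ℂ :=
  Matrix.of fun j i => (linExt h (Matrix.single i j 1) : ℂ)
    - Complex.I * (linExt h (Matrix.single i j Complex.I) : ℂ)

theorem repM_trace {d : ℕ} {h : Matrix (Fin d) (Fin d) ℂ → ℝ} (ha : AffOn h)
    (A : Matrix (Fin d) (Fin d) ℂ) : ((A * repM h).trace).re = linExt h A := by
  have e : linExt h A = linMap ha A := rfl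
  rw [e]
  conv_rhs => rw [matrix_eq_sum_single A]
  simp only [map_sum, trace, diag, mul_apply, Complex.re_sum]
  refine Finset.sum_congr rfl fun i _ => Finset.sum_congr rfl fun j _ => ?_
  have e2 : Matrix.single i j (A i j) = (A i j).re • Matrix.single i j (1 : ℂ)
      + (A i j).im • Matrix.single i j Complex.I := by
    rw [smul_single, smul_single, ← single_add]
    congr 1
    simp [Complex.re_add_im]
  rw [e2, map_add, map_smul, map_smul]
  simp [repM, linMap]

theorem repM_trace_psd {d : ℕ} {h : Matrix (Fin d) (Fin d) ℂ → ℝ} (ha : AffOn h)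
    {A : Matrix (Fin d) (Fin d) ℂ} (hA : A.PosSemidef) :
    (A * repM h).trace = (coneExt h A : ℂ) := by
  apply Complex.ext
  · rw [repM_trace ha, linExt_psd ha hA, Complex.ofReal_re]
  · have := repM_trace ha (Complex.I • A)
    rw [linExt_skew ha (by rw [conjTranspose_smul, hA.1]; simp), smul_mul_assoc, trace_smul] at this
    simpa using this

theorem repM_psd {d : ℕ} {h : Matrix (Fin d) (Fin d) ℂ → ℝ} (ha : AffOn h)
    (hn : ∀ ρ : Matrix (Fin d) (Fin d) ℂ, ρ.PosSemidef → ρ.trace = 1 → 0 ≤ h ρ) :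
    (repM h).PosSemidef := by
  have key : ∀ v : Fin d → ℂ, 0 ≤ star v ⬝ᵥ (repM h *ᵥ v) := by
    intro v
    have e := repM_trace_psd ha (posSemidef_vecMulVec_self_star v)
    have e2 : (vecMulVec v (star v) * repM h).trace = star v ⬝ᵥ (repM h *ᵥ v) := by
      rw [trace_mul_comm, mul_vecMulVec, trace_vecMulVec, dotProduct_comm]
    rw [← e2, e]
    exact_mod_cast coneExt_nonneg hn (posSemidef_vecMulVec_self_star v)
  refine PosSemidef.of_dotProduct_mulVec_nonneg ?_ key
  have hz : ∀ A : Matrix (Fin d) (Fin d) ℂ, ((A * ((repM h)ᴴ - repM h)).trace).re = 0 := by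
    intro A
    have e1 : (A * (repM h)ᴴ).trace = star (Aᴴ * repM h).trace := by
      rw [← trace_conjTranspose, conjTranspose_mul, conjTranspose_conjTranspose, trace_mul_comm]
    have e2 : linExt h Aᴴ = linExt h A := by
      simp [linExt, pPart, nPart, hPart, add_comm Aᴴ A]
    have e3 : (star (Aᴴ * repM h).trace).re = (Aᴴ * repM h).trace.re := Complex.conj_re _
    rw [mul_sub, trace_sub, Complex.sub_re, e1, e3, repM_trace ha, repM_trace ha, e2, sub_self]
  have h2 := psd_zero (posSemidef_conjTranspose_mul_self _) (hz ((repM h)ᴴ - repM h)ᴴ)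
  exact sub_eq_zero.1 (conjTranspose_mul_self_eq_zero.1 h2)

/-- Paper's Theorem 2 (finite-outcome version): every affine map from density
matrices to probability distributions on a finite outcome set is given by a POVM
via the trace rule. -/
theorem affine_map_is_povm
    {d : ℕ} {X : Type*} [Fintype X]
    (f : Matrix (Fin d) (Fin d) ℂ → X → ℝ)
    (hprob : ∀ ρ : Matrix (Fin d) (Fin d) ℂ, ρ.PosSemidef → ρ.trace = 1 →
      (∀ x, 0 ≤ f ρ x) ∧ ∑ x, f ρ x = 1)
    (haffine : ∀ ρ σ : Matrix (Fin d) (Fin d) ℂ, ρ.PosSemidef → ρ.trace = 1 →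
      σ.PosSemidef → σ.trace = 1 → ∀ t : ℝ, 0 ≤ t → t ≤ 1 →
      ∀ x, f ((t : ℂ) • ρ + ((1 - t : ℝ) : ℂ) • σ) x = t * f ρ x + (1 - t) * f σ x) :
    ∃ M : X → Matrix (Fin d) (Fin d) ℂ,
      (∀ x, (M x).PosSemidef) ∧ (∑ x, M x = 1) ∧
      ∀ ρ : Matrix (Fin d) (Fin d) ℂ, ρ.PosSemidef → ρ.trace = 1 →
        ∀ x, f ρ x = ((ρ * M x).trace).re := by
  have ha : ∀ x, AffOn (fun ρ => f ρ x) := fun x ρ σ h1 h2 h3 h4 t h5 h6 =>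
    haffine ρ σ h1 h2 h3 h4 t h5 h6 x
  refine ⟨fun x => repM (fun ρ => f ρ x), fun x => repM_psd (ha x)
    fun ρ h1 h2 => (hprob ρ h1 h2).1 x, ?_, ?_⟩
  · have hcone : ∀ A : Matrix (Fin d) (Fin d) ℂ, A.PosSemidef →
        ∑ x, coneExt (fun ρ => f ρ x) A = A.trace.re := by
      intro A hA
      unfold coneExt
      rw [← Finset.mul_sum]
      by_cases h0 : A.trace.re = 0
      · simp [h0]
      · rw [(hprob _ (norm_state hA h0).1 (norm_state hA h0).2).2, mul_one]
    have hlin : ∀ A : Matrix (Fin d) (Fin d) ℂ,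
        ((A * (∑ x, repM (fun ρ => f ρ x) - 1)).trace).re = 0 := by
      intro A
      rw [mul_sub, trace_sub, Finset.mul_sum, trace_sum, Complex.sub_re, Complex.re_sum, mul_one]
      rw [Finset.sum_congr rfl fun x _ => repM_trace (ha x) A]
      unfold linExt
      rw [Finset.sum_sub_distrib, hcone _ (pPart_psd A), hcone _ (nPart_psd A), ← Complex.sub_re,
        ← trace_sub, p_sub_n]
      simp [hPart, trace_smul, trace_add, trace_conjTranspose]
      ring
    rw [← sub_eq_zero]
    have h1 := hlin (∑ x, repM (fun ρ => f ρ x) - 1)ᴴ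
    have h2 := psd_zero (posSemidef_conjTranspose_mul_self _) h1
    exact conjTranspose_mul_self_eq_zero.1 h2
  · intro ρ h1 h2 x
    rw [repM_trace (ha x), linExt_psd (ha x) h1]
    simp [coneExt, h2]
end

section
/- Let (M x)_{x∈X} be a POVM with finite outcome set X on ℂ^d. Then there exist a dimension k, a unit vector ψ₀ ∈ ℂ^k, a unitary matrix U on ℂ^d ⊗ ℂ^k (a (d·k)×(d·k) complex matrix with U·U* = 1), and a family (Π x)_{x∈X} of Hermitian idempotent matrices on ℂ^d ⊗ ℂ^k with Π x · Π y = 0 for x ≠ y and ∑_{x∈X} Π x = 1, such that for every density matrix ρ on ℂ^d and every x ∈ X: trace(ρ · M x) = trace(U · (ρ ⊗ ψ₀ψ₀*) · U* · Π x), where ⊗ denotes the Kronecker product and ψ₀ψ₀* is the rank-one projector onto the span of ψ₀. -/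
open Matrix BigOperators
open scoped ComplexOrder Kronecker

open scoped MatrixOrder Matrix.Norms.L2Operator in
theorem naimark_sqrt_aux {d : ℕ} {A : Matrix (Fin d) (Fin d) ℂ} (hA : A.PosSemidef) :
    ∃ B : Matrix (Fin d) (Fin d) ℂ, A = Bᴴ * B :=
  CStarAlgebra.nonneg_iff_eq_star_mul_self.mp hA.nonneg

/-- Paper's Theorem 3 (Naimark dilation): every POVM is realized by coupling to an
ancilla in a fixed pure state, applying a unitary evolution, and performing a
simple (projective) measurement. -/
theorem naimark_dilation
    {d : ℕ} {X : Type*} [Fintype X] [DecidableEq X]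
    (M : X → Matrix (Fin d) (Fin d) ℂ)
    (hM : ∀ x, (M x).PosSemidef) (hMsum : ∑ x, M x = 1) :
    ∃ (k : ℕ) (ψ₀ : Fin k → ℂ)
      (U : Matrix (Fin d × Fin k) (Fin d × Fin k) ℂ)
      (P : X → Matrix (Fin d × Fin k) (Fin d × Fin k) ℂ),
      (∑ i, (starRingEnd ℂ) (ψ₀ i) * ψ₀ i = 1) ∧
      U * Uᴴ = 1 ∧
      (∀ x, (P x).IsHermitian) ∧ (∀ x, P x * P x = P x) ∧
      (∀ x y, x ≠ y → P x * P y = 0) ∧ (∑ x, P x = 1) ∧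
      ∀ ρ : Matrix (Fin d) (Fin d) ℂ, ρ.PosSemidef → ρ.trace = 1 →
        ∀ x, (ρ * M x).trace
          = (U * (ρ ⊗ₖ Matrix.vecMulVec ψ₀ (star ψ₀)) * Uᴴ * P x).trace := by
  classical
  rcases isEmpty_or_nonempty X with hX | hX
  · have h01 : (0 : Matrix (Fin d) (Fin d) ℂ) = 1 := by simpa using hMsum
    have hd : IsEmpty (Fin d) := by
      refine ⟨fun i => ?_⟩
      have := congrFun (congrFun h01 i) i
      simp at this
    refine ⟨1, fun _ => 1, 1, fun _ => 0, by simp, by simp, fun x => hX.elim x, fun x => hX.elim x,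
      fun x => hX.elim x, ?_, fun _ _ _ x => hX.elim x⟩
    ext i
    exact hd.elim i.1
  have hB : ∀ x, ∃ B : Matrix (Fin d) (Fin d) ℂ, M x = Bᴴ * B := fun x =>
    naimark_sqrt_aux (hM x)
  choose B hB using hB
  let e := Fintype.equivFin X
  let k0 : Fin (Fintype.card X) := e hX.some
  let v : Fin d × Fin (Fintype.card X) → EuclideanSpace ℂ (Fin d × Fin (Fintype.card X)) :=
    fun c => WithLp.toLp 2 (fun a => B (e.symm a.2) a.1 c.1)
  have hv : Orthonormal ℂ (Set.domRestrict {c : Fin d × Fin (Fintype.card X) | c.2 = k0} v) := by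
    rw [orthonormal_iff_ite]
    rintro ⟨⟨i, c⟩, hc⟩ ⟨⟨j, c'⟩, hc'⟩
    simp only [Set.mem_ofPred_eq] at hc hc'
    subst hc
    subst hc'
    have h := congrFun (congrFun hMsum i) j
    rw [Matrix.sum_apply] at h
    simp only [hB, Matrix.mul_apply, Matrix.conjTranspose_apply, Matrix.one_apply] at h
    simp only [Set.domRestrict_apply, v, PiLp.inner_apply, Fintype.sum_prod_type, Subtype.mk.injEq,
      Prod.mk.injEq, and_true]
    rw [← h, Finset.sum_comm, ← e.sum_comp]
    simp [mul_comm]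
  obtain ⟨b, hb⟩ := hv.exists_orthonormalBasis_extension_of_card_eq (by simp)
  let U : Matrix (Fin d × Fin (Fintype.card X)) (Fin d × Fin (Fintype.card X)) ℂ :=
    Matrix.of fun a c => b c a
  have hU : ∀ a j, U a (j, k0) = B (e.symm a.2) a.1 j := by
    intro a j
    simp only [U, Matrix.of_apply]
    rw [hb (j, k0) rfl]
  refine ⟨Fintype.card X, Pi.single k0 1, U,
    fun x => Matrix.diagonal fun p => if p.2 = e x then 1 else 0, ?_, ?_, ?_, ?_, ?_, ?_, ?_⟩
  · simp [Pi.single_apply]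
  · rw [mul_eq_one_comm]
    ext c c'
    have h := (orthonormal_iff_ite.mp b.orthonormal) c c'
    rw [PiLp.inner_apply] at h
    rw [Matrix.mul_apply, Matrix.one_apply, ← h]
    simp [U, mul_comm]
  · intro x
    rw [Matrix.IsHermitian, Matrix.diagonal_conjTranspose]
    congr 1
    ext p
    simp [apply_ite]
  · intro x
    simp [Matrix.diagonal_mul_diagonal]
  · intro x y hxy
    rw [Matrix.diagonal_mul_diagonal, ← Matrix.diagonal_zero]
    congr 1
    ext p
    by_cases h : p.2 = e x
    · simp [h, hxy]
    · simp [h]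
  · ext p q
    rw [Matrix.sum_apply]
    by_cases h : p = q
    · subst h
      simp only [Matrix.diagonal_apply_eq, Matrix.one_apply_eq]
      rw [Finset.sum_eq_single (e.symm p.2)]
      · simp
      · intro y _ hy
        rw [if_neg]
        intro h
        exact hy (by simp [h])
      · simp
    · simp [h]
  · intro ρ _ _ x
    have key : ∀ a a' : Fin d × Fin (Fintype.card X),
        (U * (ρ ⊗ₖ Matrix.vecMulVec (Pi.single k0 1) (star (Pi.single k0 1))) * Uᴴ : Matrix _ _ ℂ) a a'
        = (B (e.symm a.2) * ρ * (B (e.symm a'.2))ᴴ) a.1 a'.1 := by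
      intro a a'
      simp only [Matrix.mul_apply, Fintype.sum_prod_type, Matrix.kroneckerMap_apply,
        Matrix.vecMulVec_apply, Matrix.conjTranspose_apply, Pi.star_apply]
      simp [Pi.single_apply, apply_ite, hU, ite_mul, mul_ite]
    rw [hB, ← Matrix.mul_assoc, Matrix.trace_mul_comm, ← Matrix.mul_assoc]
    simp only [Matrix.trace, Matrix.diag_apply, Matrix.mul_diagonal, key, Fintype.sum_prod_type]
    simp
end
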